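/- Let N ≥ 1, let c ∈ ℝ^N, and let β̄ ∈ ℝ^{2N−1} be componentwise nonnegative such that the PE-zonotope Z = Z(G^{PE},c,β̄) is full-dimensional. Then Z has at most N² + N facets; moreover, if β̄_i > 0 for all i, then Z has exactly N² + N facets. -/

import Mathlib

open Matrix Finset

noncomputable section

/-- The zonotope `Z(G, c, β̄) = {c + Gβ : -β̄ ≤ β ≤ β̄}`. -/
def zonotope {N : ℕ} {ι : Type*} [Fintype ι] (G : Matrix (Fin N) ι ℝ) (c : Fin N → ℝ)
    (βb : ι → ℝ) : Set (Fin N → ℝ) :=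
  {z | ∃ β : ι → ℝ, (∀ i, -βb i ≤ β i ∧ β i ≤ βb i) ∧ z = c + G.mulVec β}

/-- The PE generator matrix `G^{PE} ∈ ℝ^{N×(2N-1)}`: its first `N` columns (indexed by
`Sum.inl`) are the standard basis vectors `e_i`, and its last `N-1` columns (indexed by
`Sum.inr j`, 0-indexed) are `(e_{j+1} - e_j)/√2`. -/
def GPE (N : ℕ) : Matrix (Fin N) (Fin N ⊕ Fin (N - 1)) ℝ :=
  Matrix.of fun n i =>
    match i with
    | Sum.inl m => if n = m then 1 else 0
    | Sum.inr j =>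
        (if (n : ℕ) = (j : ℕ) + 1 then 1 else if (n : ℕ) = (j : ℕ) then -1 else 0) /
          Real.sqrt 2

/-- `F` is the exposed face of `Z` in the direction of the (nonzero) normal vector `v`,
i.e. the set of points of `Z` maximizing `z ↦ ⟨v, z⟩` over `Z`. -/
def IsExposedFaceWithNormal {N : ℕ} (Z F : Set (Fin N → ℝ)) (v : Fin N → ℝ) : Prop :=
  v ≠ 0 ∧ F = {z ∈ Z | ∀ z' ∈ Z, v ⬝ᵥ z' ≤ v ⬝ᵥ z}

/-- `F` is a facet of `Z`: an exposed face whose affine span has dimension `N - 1`. -/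
def IsFacet {N : ℕ} (Z F : Set (Fin N → ℝ)) : Prop :=
  (∃ v, IsExposedFaceWithNormal Z F v) ∧
    Module.finrank ℝ (affineSpan ℝ F).direction = N - 1

/-- The set of maximizers of `⟨v, ·⟩` over `Z`. -/
def exposedFace {N : ℕ} (Z : Set (Fin N → ℝ)) (v : Fin N → ℝ) : Set (Fin N → ℝ) :=
  {z ∈ Z | ∀ z' ∈ Z, v ⬝ᵥ z' ≤ v ⬝ᵥ z}

theorem exposedFace_smul {N : ℕ} (Z : Set (Fin N → ℝ)) (v : Fin N → ℝ) {t : ℝ} (ht : 0 < t) :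
    exposedFace Z (t • v) = exposedFace Z v := by
  ext z
  simp only [exposedFace, Set.mem_ofPred_eq, smul_dotProduct, smul_eq_mul,
    mul_le_mul_iff_right₀ ht]

theorem sign_mul_mem_box {ι : Type*} {b : ι → ℝ} (hb : ∀ i, 0 ≤ b i) (s : ι → ℝ) (i : ι) :
    -b i ≤ (SignType.sign (s i) : ℝ) * b i ∧ (SignType.sign (s i) : ℝ) * b i ≤ b i := by
  have := hb i
  rcases lt_trichotomy (s i) 0 with h | h | h
  · simp [sign_neg h]; linarith
  · simp [h, this]
  · simp [sign_pos h]; linarith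

section Zonotope

variable {N : ℕ} {ι : Type*} [Fintype ι] {G : Matrix (Fin N) ι ℝ} {c : Fin N → ℝ} {b : ι → ℝ}

theorem dotProduct_add_mulVec (v : Fin N → ℝ) (β : ι → ℝ) :
    v ⬝ᵥ (c + G *ᵥ β) = v ⬝ᵥ c + ∑ i, (v ᵥ* G) i * β i := by
  rw [dotProduct_add, dotProduct_mulVec]
  rfl

/-- A point of a zonotope lies on the face with normal `v` iff each coefficient is extremal in
the direction given by the sign of the pairing of `v` with the generator. -/
theorem mem_exposedFace_zonotope (hb : ∀ i, 0 ≤ b i) (v : Fin N → ℝ) {β : ι → ℝ}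
    (hβ : ∀ i, -b i ≤ β i ∧ β i ≤ b i) :
    c + G *ᵥ β ∈ exposedFace (zonotope G c b) v ↔
      ∀ i, (v ᵥ* G) i * β i = |(v ᵥ* G) i| * b i := by
  have key : ∀ γ : ι → ℝ, (∀ i, -b i ≤ γ i ∧ γ i ≤ b i) →
      ∀ i, (v ᵥ* G) i * γ i ≤ |(v ᵥ* G) i| * b i := fun γ hγ i => by
    calc (v ᵥ* G) i * γ i ≤ |(v ᵥ* G) i * γ i| := le_abs_self _
      _ = |(v ᵥ* G) i| * |γ i| := abs_mul _ _
      _ ≤ _ := by gcongr; exact abs_le.2 (hγ i)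
  constructor
  · rintro ⟨-, h⟩
    have h1 := h _ ⟨_, sign_mul_mem_box hb (v ᵥ* G), rfl⟩
    rw [dotProduct_add_mulVec, dotProduct_add_mulVec] at h1
    simp only [← mul_assoc, self_mul_sign] at h1
    have h2 := (Finset.sum_eq_sum_iff_of_le fun i _ => key β hβ i).1
      (le_antisymm (Finset.sum_le_sum fun i _ => key β hβ i) (by linarith))
    exact fun i => h2 i (Finset.mem_univ i)
  · refine fun h => ⟨⟨β, hβ, rfl⟩, ?_⟩
    rintro _ ⟨γ, hγ, rfl⟩
    rw [dotProduct_add_mulVec, dotProduct_add_mulVec]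
    refine add_le_add_right (Finset.sum_le_sum fun i _ => ?_) _
    rw [h i]
    exact key γ hγ i

theorem sign_mem_exposedFace (hb : ∀ i, 0 ≤ b i) (v : Fin N → ℝ) :
    (c + G *ᵥ fun i => (SignType.sign ((v ᵥ* G) i) : ℝ) * b i) ∈
      exposedFace (zonotope G c b) v := by
  rw [mem_exposedFace_zonotope hb v (sign_mul_mem_box hb (v ᵥ* G))]
  intro i
  rw [← mul_assoc, self_mul_sign]

theorem dotProduct_eq_zero_of_mem_direction (hb : ∀ i, 0 ≤ b i) {u v : Fin N → ℝ}
    (huv : ∀ i, (v ᵥ* G) i = 0 → (u ᵥ* G) i = 0) {d : Fin N → ℝ}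
    (hd : d ∈ (affineSpan ℝ (exposedFace (zonotope G c b) v)).direction) : u ⬝ᵥ d = 0 := by
  suffices h : (affineSpan ℝ (exposedFace (zonotope G c b) v)).direction ≤
      LinearMap.ker (dotProductBilin ℝ ℝ u) from h hd
  rw [direction_affineSpan, vectorSpan_def, Submodule.span_le]
  rintro _ ⟨z, hz, z', hz', rfl⟩
  obtain ⟨β, hβ, rfl⟩ := hz.1
  obtain ⟨γ, hγ, rfl⟩ := hz'.1
  rw [mem_exposedFace_zonotope hb v hβ] at hz
  rw [mem_exposedFace_zonotope hb v hγ] at hz'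
  change u ⬝ᵥ (_ - _) = 0
  rw [dotProduct_sub, dotProduct_add_mulVec, dotProduct_add_mulVec, sub_eq_zero]
  congr 1
  refine Finset.sum_congr rfl fun i _ => ?_
  by_cases h : (v ᵥ* G) i = 0
  · simp [huv i h]
  · rw [mul_left_cancel₀ h ((hz i).trans (hz' i).symm)]

theorem col_mem_direction (hb : ∀ i, 0 ≤ b i) (v : Fin N → ℝ) {i : ι} (hi : 0 < b i)
    (hv : (v ᵥ* G) i = 0) :
    G.col i ∈ (affineSpan ℝ (exposedFace (zonotope G c b) v)).direction := by
  classical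
  set β : ι → ℝ := fun i => (SignType.sign ((v ᵥ* G) i) : ℝ) * b i with hβ
  have hγ : ∀ k, -b k ≤ (β + Pi.single i (b i) : ι → ℝ) k ∧
      (β + Pi.single i (b i) : ι → ℝ) k ≤ b k := by
    intro k
    rcases eq_or_ne k i with rfl | hk
    · simp [hβ, hv, hi.le]
    · simpa [hk] using sign_mul_mem_box hb (v ᵥ* G) k
  have h1 : c + G *ᵥ (β + Pi.single i (b i) : ι → ℝ) ∈ exposedFace (zonotope G c b) v := by
    rw [mem_exposedFace_zonotope hb v hγ]
    intro k
    rcases eq_or_ne k i with rfl | hk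
    · simp [hv]
    · simp [hk, hβ, ← mul_assoc]
  have h2 := AffineSubspace.vsub_mem_direction (subset_affineSpan ℝ _ h1)
    (subset_affineSpan ℝ _ (sign_mem_exposedFace (G := G) (c := c) hb v))
  rw [mulVec_add, mulVec_single, vsub_eq_sub] at h2
  have h3 := Submodule.smul_mem _ (b i)⁻¹ h2
  convert h3 using 1
  ext n
  simp [hβ]
  field_simp

theorem sign_eq_of_exposedFace_eq (hb : ∀ i, 0 < b i) {v w : Fin N → ℝ}
    (h : exposedFace (zonotope G c b) v = exposedFace (zonotope G c b) w) {i : ι}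
    (hi : (w ᵥ* G) i ≠ 0) : SignType.sign ((v ᵥ* G) i) = SignType.sign ((w ᵥ* G) i) := by
  have hb' := fun i => (hb i).le
  have h1 := sign_mem_exposedFace (G := G) (c := c) hb' v
  rw [h, mem_exposedFace_zonotope hb' w (sign_mul_mem_box hb' _)] at h1
  have h2 := h1 i
  rw [← mul_assoc] at h2
  have h3 := mul_right_cancel₀ (hb i).ne' h2
  rw [← self_mul_sign] at h3
  have h4 := mul_left_cancel₀ hi h3
  revert h4
  generalize SignType.sign ((v ᵥ* G) i) = p
  generalize SignType.sign ((w ᵥ* G) i) = q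
  cases p <;> cases q <;> norm_num

end Zonotope

theorem vecMul_GPE_inl {N : ℕ} (v : Fin N → ℝ) (m : Fin N) : (v ᵥ* GPE N) (Sum.inl m) = v m := by
  simp [vecMul, dotProduct, GPE]

theorem vecMul_GPE_inr {N : ℕ} (v : Fin N → ℝ) (j : Fin (N - 1)) :
    (v ᵥ* GPE N) (Sum.inr j) =
      (v ⟨j + 1, by omega⟩ - v ⟨j, by omega⟩) / Real.sqrt 2 := by
  have h : ∀ n : Fin N, v n * ((if (n : ℕ) = (j : ℕ) + 1 then (1 : ℝ) else
      if (n : ℕ) = (j : ℕ) then -1 else 0) / Real.sqrt 2) =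
      ((if n = ⟨j + 1, by omega⟩ then v n else 0) -
        (if n = ⟨j, by omega⟩ then v n else 0)) / Real.sqrt 2 := by
    intro n
    simp only [Fin.ext_iff]
    split_ifs <;> first | omega | ring
  simp only [vecMul, dotProduct, GPE, of_apply]
  rw [Finset.sum_congr rfl fun n _ => h n, ← Finset.sum_div, Finset.sum_sub_distrib]
  simp

theorem vecMul_GPE_inr_eq_zero {N : ℕ} (v : Fin N → ℝ) (j : Fin (N - 1)) :
    (v ᵥ* GPE N) (Sum.inr j) = 0 ↔ v ⟨j + 1, by omega⟩ = v ⟨j, by omega⟩ := by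
  rw [vecMul_GPE_inr, div_eq_zero_iff, sub_eq_zero]
  simp

/-- The vector `𝟙_{[0, y)} - 𝟙_{[0, x)}`, that is, plus or minus the indicator of the
interval between `x` and `y`. -/
def stepVec (N x y : ℕ) (m : Fin N) : ℝ :=
  (if (m : ℕ) < y then 1 else 0) - if (m : ℕ) < x then 1 else 0

theorem stepVec_pos {N x y : ℕ} {m : Fin N} : 0 < stepVec N x y m ↔ x ≤ m ∧ (m : ℕ) < y := by
  unfold stepVec
  split_ifs <;> norm_num <;> omega

theorem stepVec_neg {N x y : ℕ} {m : Fin N} : stepVec N x y m < 0 ↔ y ≤ m ∧ (m : ℕ) < x := by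
  unfold stepVec
  split_ifs <;> norm_num <;> omega

theorem stepVec_swap (N x y : ℕ) : stepVec N y x = -stepVec N x y := by
  ext m
  simp [stepVec]

theorem stepVec_of_le {N x y : ℕ} (h : x ≤ y) (m : Fin N) :
    stepVec N x y m = if x ≤ (m : ℕ) ∧ (m : ℕ) < y then 1 else 0 := by
  unfold stepVec
  split_ifs <;> first | omega | norm_num

theorem stepVec_ne_zero {N : ℕ} {x y : Fin (N + 1)} (h : x ≠ y) : stepVec N x y ≠ 0 := by
  intro h0
  rcases lt_or_gt_of_ne h with h | h
  · have := stepVec_pos (m := (⟨x, by omega⟩ : Fin N)).2 ⟨le_refl (x : ℕ), h⟩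
    simp [h0] at this
  · have := stepVec_neg (m := (⟨y, by omega⟩ : Fin N)).2 ⟨le_refl (y : ℕ), h⟩
    simp [h0] at this

theorem stepVec_sign_injective {N : ℕ} {x y x' y' : Fin (N + 1)} (h' : x' ≠ y')
    (hs : ∀ m, SignType.sign (stepVec N x y m) = SignType.sign (stepVec N x' y' m)) :
    x = x' ∧ y = y' := by
  have hp : ∀ m : ℕ, m < N → (((x : ℕ) ≤ m ∧ m < y) ↔ ((x' : ℕ) ≤ m ∧ m < y')) := by
    intro m hm
    have := hs ⟨m, hm⟩
    rw [← stepVec_pos (m := ⟨m, hm⟩), ← stepVec_pos (m := ⟨m, hm⟩), ← sign_eq_one_iff, this,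
      sign_eq_one_iff]
  have hn : ∀ m : ℕ, m < N → (((y : ℕ) ≤ m ∧ m < x) ↔ ((y' : ℕ) ≤ m ∧ m < x')) := by
    intro m hm
    have := hs ⟨m, hm⟩
    rw [← stepVec_neg (m := ⟨m, hm⟩), ← stepVec_neg (m := ⟨m, hm⟩), ← sign_eq_neg_one_iff, this,
      sign_eq_neg_one_iff]
  simp only [ne_eq, Fin.ext_iff] at *
  have := hp x; have := hp y; have := hp x'; have := hp y'
  have := hn x; have := hn y; have := hn x'; have := hn y'
  omega

/-- A vector annihilated by every generator that annihilates `stepVec N x y` is a multiple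
of it. -/
theorem eq_smul_stepVec_of_lt {N x y : ℕ} (hxy : x < y) {u : Fin N → ℝ}
    (hu : ∀ i, (stepVec N x y ᵥ* GPE N) i = 0 → (u ᵥ* GPE N) i = 0) :
    ∃ t : ℝ, u = t • stepVec N x y := by
  have h0 : ∀ m : Fin N, ¬ (x ≤ (m : ℕ) ∧ (m : ℕ) < y) → u m = 0 := fun m hm => by
    have := hu (Sum.inl m)
    rw [vecMul_GPE_inl, vecMul_GPE_inl, stepVec_of_le hxy.le, if_neg hm] at this
    exact this rfl
  by_cases hxN : x < N
  · have h1 : ∀ k (hk : x + k < N), x + k < y → u ⟨x + k, hk⟩ = u ⟨x, hxN⟩ := by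
      intro k
      induction k with
      | zero => intros; rfl
      | succ k ih =>
        intro hk hky
        rw [← ih (by omega) (by omega)]
        have := hu (Sum.inr ⟨x + k, by omega⟩)
        rw [vecMul_GPE_inr_eq_zero, vecMul_GPE_inr_eq_zero] at this
        apply this
        rw [stepVec_of_le hxy.le, stepVec_of_le hxy.le, if_pos, if_pos] <;> simp <;> omega
    refine ⟨u ⟨x, hxN⟩, funext fun m => ?_⟩
    simp only [Pi.smul_apply, smul_eq_mul, stepVec_of_le hxy.le]
    split_ifs with hm
    · obtain ⟨k, hk⟩ := Nat.exists_eq_add_of_le hm.1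
      have := h1 k (by omega) (by omega)
      simpa [← hk] using this
    · simpa using h0 m hm
  · exact ⟨0, funext fun m => by simpa using h0 m (by omega)⟩

theorem eq_smul_stepVec {N x y : ℕ} (hxy : x ≠ y) {u : Fin N → ℝ}
    (hu : ∀ i, (stepVec N x y ᵥ* GPE N) i = 0 → (u ᵥ* GPE N) i = 0) :
    ∃ t : ℝ, u = t • stepVec N x y := by
  rcases lt_or_gt_of_ne hxy with h | h
  · exact eq_smul_stepVec_of_lt h hu
  · obtain ⟨t, ht⟩ := eq_smul_stepVec_of_lt h (u := u) fun i hi => hu i (by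
      rw [stepVec_swap, neg_vecMul, Pi.neg_apply, hi, neg_zero])
    exact ⟨-t, by rw [ht, stepVec_swap N x y]; simp⟩

/-- Around each index there is a maximal interval `[x, y)` of constancy of `v`. -/
theorem exists_maximal_constant_interval {N : ℕ} (v : Fin N → ℝ) (i : Fin N) :
    ∃ x y : ℕ, x ≤ i ∧ (i : ℕ) < y ∧ y ≤ N ∧
      (∀ m : Fin N, x ≤ (m : ℕ) → (m : ℕ) < y → v m = v i) ∧
      (∀ m n : Fin N, (n : ℕ) = m + 1 → v n = v m →
        ((x ≤ (m : ℕ) ∧ (m : ℕ) < y) ↔ (x ≤ (n : ℕ) ∧ (n : ℕ) < y))) := by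
  classical
  have hx : ∃ x : ℕ, ∀ m : Fin N, x ≤ (m : ℕ) → m ≤ i → v m = v i :=
    ⟨i, fun m h1 h2 => by rw [le_antisymm h2 h1]⟩
  have hxi : Nat.find hx ≤ i := Nat.find_min' hx fun m h1 h2 => by rw [le_antisymm h2 h1]
  have hy : ∃ y : ℕ, N ≤ y ∨ ∃ h : y < N, i < ⟨y, h⟩ ∧ v ⟨y, h⟩ ≠ v i := ⟨N, Or.inl le_rfl⟩
  have hiy : (i : ℕ) < Nat.find hy := by
    rcases Nat.find_spec hy with h | ⟨h, h1, -⟩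
    · exact i.2.trans_le h
    · exact h1
  have hyc : ∀ m : Fin N, i ≤ m → (m : ℕ) < Nat.find hy → v m = v i := by
    intro m h1 h2
    have := Nat.find_min hy h2
    push Not at this
    rcases h1.eq_or_lt with rfl | h1
    · rfl
    · exact this.2 m.2 h1
  have hc : ∀ m : Fin N, Nat.find hx ≤ (m : ℕ) → (m : ℕ) < Nat.find hy → v m = v i := by
    intro m h1 h2
    rcases le_total m i with h | h
    · exact Nat.find_spec hx m h1 h
    · exact hyc m h h2
  refine ⟨Nat.find hx, Nat.find hy, hxi, hiy, Nat.find_min' hy (Or.inl le_rfl), hc, ?_⟩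
  intro m n hmn hv
  constructor
  · rintro ⟨h1, h2⟩
    refine ⟨by omega, ?_⟩
    by_contra h3
    have h4 : Nat.find hy = n := by omega
    rcases Nat.find_spec hy with h | ⟨h, -, h5⟩
    · omega
    · simp only [h4] at h5
      exact h5 (hv.trans (hc m h1 h2))
  · rintro ⟨h1, h2⟩
    refine ⟨?_, by omega⟩
    by_contra h3
    refine h3 (Nat.find_min' hx fun k hk hki => ?_)
    rcases hk.eq_or_lt with h | h
    · rw [← Fin.ext h, ← hv]
      exact hc n h1 h2
    · exact Nat.find_spec hx k (by omega) hki

/-- If `v` is determined up to scaling by the generators orthogonal to it, then it is a positive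
multiple of some `stepVec`. -/
theorem exists_eq_smul_stepVec {N : ℕ} {v : Fin N → ℝ} (hv : v ≠ 0)
    (h : ∀ u : Fin N → ℝ, (∀ i, (v ᵥ* GPE N) i = 0 → (u ᵥ* GPE N) i = 0) →
      ∀ d, v ⬝ᵥ d = 0 → u ⬝ᵥ d = 0) :
    ∃ x y : Fin (N + 1), x ≠ y ∧ ∃ t : ℝ, 0 < t ∧ v = t • stepVec N x y := by
  obtain ⟨i, hi⟩ := Function.ne_iff.1 hv
  obtain ⟨x, y, hxi, hiy, hyN, hc, hm⟩ := exists_maximal_constant_interval v i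
  have hxy : x ≤ y := by omega
  have hu := h (stepVec N x y) (by
    rintro (m | j) hj
    · rw [vecMul_GPE_inl] at hj ⊢
      rw [stepVec_of_le hxy, if_neg]
      rintro ⟨h1, h2⟩
      exact hi ((hc m h1 h2).symm.trans hj)
    · rw [vecMul_GPE_inr_eq_zero] at hj ⊢
      have := hm ⟨j, by omega⟩ ⟨j + 1, by omega⟩ rfl hj
      rw [stepVec_of_le hxy, stepVec_of_le hxy]
      exact if_congr this.symm rfl rfl)
  have hvi : v = v i • stepVec N x y := by
    ext m
    have := hu (v i • Pi.single m 1 - v m • Pi.single i 1) (by simp; ring)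
    simp [stepVec_of_le hxy i, hxi, hiy] at this
    simp
    linarith
  rcases lt_or_gt_of_ne hi with h0 | h0
  · refine ⟨⟨y, by omega⟩, ⟨x, by omega⟩, by simp; omega, -v i, neg_pos.2 h0, ?_⟩
    rw [stepVec_swap, smul_neg, neg_smul, neg_neg]
    exact hvi
  · exact ⟨⟨x, by omega⟩, ⟨y, by omega⟩, by simp; omega, v i, h0, hvi⟩

theorem finrank_ker_dotProduct {N : ℕ} {v : Fin N → ℝ} (hv : v ≠ 0) :
    Module.finrank ℝ (LinearMap.ker (dotProductBilin ℝ ℝ v)) = N - 1 := by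
  have h : dotProductBilin ℝ ℝ v ≠ 0 := fun h0 =>
    hv (dotProduct_self_eq_zero.1 (LinearMap.congr_fun h0 v))
  have := Module.Dual.finrank_ker_add_one_of_ne_zero h
  simp only [Module.finrank_fin_fun] at this
  omega

theorem exists_stepVec_of_isFacet {N : ℕ} {c : Fin N → ℝ} {b : Fin N ⊕ Fin (N - 1) → ℝ}
    (hb : ∀ i, 0 ≤ b i) {F : Set (Fin N → ℝ)} (hF : IsFacet (zonotope (GPE N) c b) F) :
    ∃ x y : Fin (N + 1), x ≠ y ∧ exposedFace (zonotope (GPE N) c b) (stepVec N x y) = F := by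
  obtain ⟨⟨v, hv, rfl⟩, hdim⟩ := hF
  change Module.finrank ℝ (affineSpan ℝ (exposedFace _ v)).direction = _ at hdim
  have hD : (affineSpan ℝ (exposedFace (zonotope (GPE N) c b) v)).direction =
      LinearMap.ker (dotProductBilin ℝ ℝ v) :=
    Submodule.eq_of_le_of_finrank_eq
      (fun d hd => dotProduct_eq_zero_of_mem_direction hb (fun _ h => h) hd)
      (hdim.trans (finrank_ker_dotProduct hv).symm)
  obtain ⟨x, y, hxy, t, ht, hvt⟩ := exists_eq_smul_stepVec hv fun u hu d hd =>
    dotProduct_eq_zero_of_mem_direction (c := c) hb hu (by rw [hD]; exact hd)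
  refine ⟨x, y, hxy, ?_⟩
  rw [← exposedFace_smul _ _ ht, ← hvt]
  rfl

theorem isFacet_exposedFace_stepVec {N : ℕ} {c : Fin N → ℝ} {b : Fin N ⊕ Fin (N - 1) → ℝ}
    (hb : ∀ i, 0 < b i) {x y : Fin (N + 1)} (hxy : x ≠ y) :
    IsFacet (zonotope (GPE N) c b) (exposedFace (zonotope (GPE N) c b) (stepVec N x y)) := by
  have hb' := fun i => (hb i).le
  refine ⟨⟨_, stepVec_ne_zero hxy, rfl⟩, ?_⟩
  refine Eq.trans ?_ (finrank_ker_dotProduct (stepVec_ne_zero hxy))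
  suffices h : (affineSpan ℝ (exposedFace (zonotope (GPE N) c b) (stepVec N x y))).direction =
      LinearMap.ker (dotProductBilin ℝ ℝ (stepVec N x y)) by rw [h]
  refine le_antisymm
    (fun d hd => dotProduct_eq_zero_of_mem_direction hb' (fun _ h => h) hd) fun d hd => ?_
  by_contra hnot
  obtain ⟨f, hfd, hf⟩ := Submodule.exists_le_ker_of_notMem hnot
  obtain ⟨u, rfl⟩ := (dotProductEquiv ℝ (Fin N)).surjective f
  obtain ⟨t, rfl⟩ := eq_smul_stepVec (N := N) (x := x) (y := y) (by simpa [Fin.ext_iff] using hxy)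
    (u := u) fun i hi => hf (col_mem_direction hb' _ (hb i) hi)
  apply hfd
  change (t • stepVec N x y) ⬝ᵥ d = 0
  rw [smul_dotProduct]
  change t • (dotProductBilin ℝ ℝ (stepVec N x y) d) = 0
  rw [hd, smul_zero]

/-- A full-dimensional PE-zonotope has finitely many facets, at most `N² + N` of them;
if moreover all entries of `β̄` are positive, it has exactly `N² + N` facets. -/
theorem card_facets_PE_zonotope {N : ℕ} (hN : 1 ≤ N) (c : Fin N → ℝ)
    (βb : Fin N ⊕ Fin (N - 1) → ℝ) (hβb : ∀ i, 0 ≤ βb i)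
    (hfull : affineSpan ℝ (zonotope (GPE N) c βb) = ⊤) :
    {F : Set (Fin N → ℝ) | IsFacet (zonotope (GPE N) c βb) F}.Finite ∧
    {F : Set (Fin N → ℝ) | IsFacet (zonotope (GPE N) c βb) F}.ncard ≤ N ^ 2 + N ∧
    ((∀ i, 0 < βb i) →
      {F : Set (Fin N → ℝ) | IsFacet (zonotope (GPE N) c βb) F}.ncard = N ^ 2 + N) := by
  set Z := zonotope (GPE N) c βb
  set P : Finset (Fin (N + 1) × Fin (N + 1)) := (Finset.univ : Finset (Fin (N + 1))).offDiag
  set f : Fin (N + 1) × Fin (N + 1) → Set (Fin N → ℝ) :=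
    fun p => exposedFace Z (stepVec N p.1 p.2)
  have hP : P.card = N ^ 2 + N := by
    rw [Finset.offDiag_card, Finset.card_univ, Fintype.card_fin,
      Nat.sub_eq_iff_eq_add (by nlinarith)]
    ring
  have hsub : {F | IsFacet Z F} ⊆ f '' P := by
    intro F hF
    obtain ⟨x, y, hxy, h⟩ := exists_stepVec_of_isFacet hβb hF
    exact ⟨(x, y), by simpa [P] using hxy, h⟩
  have hfin : (f '' P).Finite := P.finite_toSet.image f
  refine ⟨hfin.subset hsub, ?_, fun hpos => ?_⟩
  · calc _ ≤ (f '' P).ncard := Set.ncard_le_ncard hsub hfin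
      _ ≤ (P : Set (Fin (N + 1) × Fin (N + 1))).ncard := Set.ncard_image_le P.finite_toSet
      _ = _ := by rw [Set.ncard_coe_finset, hP]
  · have heq : {F | IsFacet Z F} = f '' P := by
      refine hsub.antisymm ?_
      rintro _ ⟨p, hp, rfl⟩
      exact isFacet_exposedFace_stepVec hpos (by simpa [P] using hp)
    rw [heq, Set.InjOn.ncard_image, Set.ncard_coe_finset, hP]
    rintro ⟨x, y⟩ hp ⟨x', y'⟩ hp' h
    have hsign : ∀ m, SignType.sign (stepVec N x y m) = SignType.sign (stepVec N x' y' m) := by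
      intro m
      have h1 := sign_eq_of_exposedFace_eq hpos h (i := Sum.inl m)
      have h2 := sign_eq_of_exposedFace_eq hpos h.symm (i := Sum.inl m)
      simp only [vecMul_GPE_inl] at h1 h2
      by_cases h0 : stepVec N x' y' m = 0
      · by_cases h0' : stepVec N x y m = 0
        · rw [h0, h0']
        · exact (h2 h0').symm
      · exact h1 h0
    have := stepVec_sign_injective (by simpa [P] using hp') hsign
    rw [this.1, this.2]
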